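/- For every pair of integers m, n ∈ ℤ, the triple of polynomials (τ0, τ1, τ2) = (s_{m,n}, s_{m,n+1}, s_{m+1,n+1}) satisfies the bilinear form of the fourth Painlevé equation with parameters (α0, α1, α2) = (3n + 2, 3(m − n) − 1, −3m + 2); explicitly, (D_x² − x·D_x − (α_i − α_{i+1})/3) τ_i·τ_{i+1} = 0 for i = 0, 1, 2 (indices mod 3), where (D_x² − x·D_x − c) F·G = F''G − 2F'G' + FG'' − x(F'G − FG') − c·FG. -/

import Mathlib

/-- `p2 c n` is the two-variable polynomial `p_n(t₁, t₂) = ∑_{i+2j=n} t₁^i t₂^j/(i!·j!)`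
with the second variable specialized to `t₂ = c`, as a polynomial in `x = t₁`. -/
noncomputable def p2 (c : ℂ) (n : ℕ) : Polynomial ℂ :=
  ∑ j ∈ Finset.range (n / 2 + 1),
    Polynomial.C (c ^ j / ((Nat.factorial (n - 2 * j) : ℂ) * (Nat.factorial j : ℂ))) *
      Polynomial.X ^ (n - 2 * j)

/-- `p_m(x, c)` for an integer index, with `p_m = 0` for `m < 0`. -/
noncomputable def p2Z (c : ℂ) (m : ℤ) : Polynomial ℂ :=
  if 0 ≤ m then p2 c m.toNat else 0

/-- The Jacobi–Trudi determinant `S_λ(x, c) = det(p_{λᵢ−i+j}(x, c))_{1≤i,j≤ℓ}`, for a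
partition recorded as `lam : ℕ → ℕ` (so `λ_{i+1} = lam i`) of length at most `ℓ`. -/
noncomputable def jacobiTrudi (c : ℂ) (ℓ : ℕ) (lam : ℕ → ℕ) : Polynomial ℂ :=
  Matrix.det (Matrix.of fun i j : Fin ℓ =>
    p2Z c ((lam i : ℤ) - (i : ℕ) + (j : ℕ)))

/-- The Maya diagram `M(m,n) = {3k : k < m} ∪ {3k+1 : k < n} ∪ {3k+2 : k < 0} ⊂ ℤ`. -/
def mayaSet (m n : ℤ) : Set ℤ :=
  {z | ∃ k < m, z = 3 * k} ∪ {z | ∃ k < n, z = 3 * k + 1} ∪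
    {z | ∃ k < (0 : ℤ), z = 3 * k + 2}

/-- `lam : ℕ → ℕ` (with `λ_{i+1} = lam i`) is the partition associated to the Maya
diagram `M`, with `c` the eventually constant value of `mᵢ + i`: i.e. `lam` is weakly
decreasing, eventually `0`, and `i ↦ λ_{i+1} − (i+1) + c` is the (strictly decreasing)
enumeration of `M`, i.e. its range is exactly `M`. -/
def IsMayaPartition (M : Set ℤ) (lam : ℕ → ℕ) (c : ℤ) : Prop :=
  Antitone lam ∧ (∃ N, ∀ i, N ≤ i → lam i = 0) ∧
    Set.range (fun i : ℕ => (lam i : ℤ) - ((i : ℤ) + 1) + c) = M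

/-- `s` is the 3-reduced Schur polynomial `s_{m,n}(x) = S_{λ(m,n)}(x, 1/2)`, where
`λ(m,n)` is the partition associated to the Maya diagram `M(m,n)`. -/
def IsOkamotoS (m n : ℤ) (s : Polynomial ℂ) : Prop :=
  ∃ (lam : ℕ → ℕ) (c : ℤ) (ℓ : ℕ),
    IsMayaPartition (mayaSet m n) lam c ∧ (∀ i, ℓ ≤ i → lam i = 0) ∧
    s = jacobiTrudi (1 / 2) ℓ lam

/-- The Hirota bilinear expression `(Dₓ² − x·Dₓ − c) F·G` for polynomials. -/
noncomputable def hirotaBil (c : ℂ) (F G : Polynomial ℂ) : Polynomial ℂ :=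
  Polynomial.derivative (Polynomial.derivative F) * G -
    2 * Polynomial.derivative F * Polynomial.derivative G +
    F * Polynomial.derivative (Polynomial.derivative G) -
    Polynomial.X * (Polynomial.derivative F * G - F * Polynomial.derivative G) -
    Polynomial.C c * (F * G)

open Polynomial

theorem updateRow_snoc_last {k : ℕ} {m R : Type*} (u : Fin k → m → R) (a b : m → R) :
    (Matrix.of (Fin.snoc (α := fun _ => m → R) u a)).updateRow (Fin.last k) b =
      Matrix.of (Fin.snoc (α := fun _ => m → R) u b) := by
  simp only [Matrix.updateRow]
  exact Fin.update_snoc_last (α := fun _ => m → R) ..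

theorem updateRow_snoc_castSucc {k : ℕ} {m R : Type*} (u : Fin k → m → R) (a b : m → R)
    (i : Fin k) :
    (Matrix.of (Fin.snoc (α := fun _ => m → R) u a)).updateRow i.castSucc b =
      Matrix.of (Fin.snoc (α := fun _ => m → R) (Function.update u i b) a) := by
  simp only [Matrix.updateRow]
  exact (Fin.snoc_update (α := fun _ => m → R) ..).symm

section DeterminantIdentities

variable {R : Type*} [CommRing R]

/-- The determinant with rows `u 0, …, u (k - 1), a, b`. -/
def borderDet {k : ℕ} (u : Fin k → Fin (k + 2) → R) (a b : Fin (k + 2) → R) : R :=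
  Matrix.det (Matrix.of (Fin.snoc (α := fun _ => Fin (k + 2) → R)
    (Fin.snoc (α := fun _ => Fin (k + 2) → R) u a) b))

theorem borderDet_self_row {k : ℕ} (u : Fin k → Fin (k + 2) → R) (a : Fin (k + 2) → R)
    (i : Fin k) : borderDet u a (u i) = 0 := by
  refine Matrix.det_zero_of_row_eq (i := i.castSucc.castSucc) (j := Fin.last _)
    (Fin.castSucc_lt_last _).ne ?_
  ext j
  simp

theorem borderDet_self {k : ℕ} (u : Fin k → Fin (k + 2) → R) (a : Fin (k + 2) → R) :
    borderDet u a a = 0 := by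
  refine Matrix.det_zero_of_row_eq (i := (Fin.last _).castSucc) (j := Fin.last _)
    (Fin.castSucc_lt_last _).ne ?_
  ext j
  simp

theorem borderDet_swap {k : ℕ} (u : Fin k → Fin (k + 2) → R) (a b : Fin (k + 2) → R) :
    borderDet u b a = -borderDet u a b := by
  have h := Matrix.detRowAlternating.map_swap (R := R)
    (Fin.snoc (α := fun _ => Fin (k + 2) → R)
      (Fin.snoc (α := fun _ => Fin (k + 2) → R) u a) b)
    (i := (Fin.last _).castSucc) (j := Fin.last _) (Fin.castSucc_lt_last _).ne
  rw [borderDet, borderDet]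
  refine Eq.trans (congrArg Matrix.det ?_) h
  ext i j
  refine Fin.lastCases ?_ (fun i => Fin.lastCases ?_ (fun i => ?_) i) i
  · simp
  · simp
  · simp [Equiv.swap_apply_of_ne_of_ne, Fin.ext_iff, i.isLt.ne,
      (i.isLt.trans (Nat.lt_succ_self k)).ne]

/-- The three-term Plücker relation. -/
theorem borderDet_plucker {k : ℕ} (u : Fin k → Fin (k + 2) → R) (a b c d : Fin (k + 2) → R) :
    borderDet u a b * borderDet u c d =
      borderDet u a c * borderDet u b d + borderDet u a d * borderDet u c b := by
  let A : Matrix (Fin (k + 2)) (Fin (k + 2)) R := Matrix.of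
    (Fin.snoc (α := fun _ => Fin (k + 2) → R) (Fin.snoc (α := fun _ => Fin (k + 2) → R) u c) d)
  let B : Matrix (Fin (k + 2)) (Fin (k + 2)) R := Matrix.of
    (Fin.snoc (α := fun _ => Fin (k + 2) → R) (Fin.snoc (α := fun _ => Fin (k + 2) → R) u a) 0)
  have hB : ∀ x, Matrix.cramer B.transpose x (Fin.last _) = borderDet u a x := fun x => by
    rw [Matrix.cramer_transpose_apply, updateRow_snoc_last]; rfl
  have h := congrArg (fun x => Matrix.cramer B.transpose x (Fin.last _))
    (Matrix.mulVec_cramer A.transpose b)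
  simp only [Matrix.mulVec_eq_sum, map_sum, Finset.sum_apply, op_smul_eq_smul,
    Matrix.transpose_transpose, map_smul, Pi.smul_apply, smul_eq_mul,
    Matrix.det_transpose] at h
  simp only [hB] at h
  rw [Fin.sum_univ_castSucc, Fin.sum_univ_castSucc] at h
  have e1 : ∀ i : Fin k, A i.castSucc.castSucc = u i := fun i => by
    funext j; simp [A]
  have e2 : A (Fin.last k).castSucc = c := by funext j; simp [A]
  have e3 : A (Fin.last (k + 1)) = d := by funext j; simp [A]
  have e4 : A.det = borderDet u c d := rfl
  have e5 : Matrix.cramer A.transpose b (Fin.last k).castSucc = borderDet u b d := by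
    rw [Matrix.cramer_transpose_apply, updateRow_snoc_castSucc, Fin.update_snoc_last]; rfl
  have e6 : Matrix.cramer A.transpose b (Fin.last (k + 1)) = borderDet u c b := by
    rw [Matrix.cramer_transpose_apply, updateRow_snoc_last]; rfl
  simp only [e1, e2, e3, e4, e5, e6, borderDet_self_row, mul_zero, Finset.sum_const_zero,
    zero_add] at h
  linear_combination -h

/-- Expansion along a last row equal to the last basis vector. -/
theorem det_snoc_single_last {n : ℕ} (v : Fin n → Fin (n + 1) → R) :
    Matrix.det (Matrix.of (Fin.snoc (α := fun _ => Fin (n + 1) → R) v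
      (Pi.single (Fin.last n) 1))) = Matrix.det (Matrix.of fun j i : Fin n => v j i.castSucc) := by
  rw [Matrix.det_succ_row _ (Fin.last n), Fin.sum_univ_castSucc]
  simp only [Matrix.of_apply, Fin.snoc_last]
  rw [Finset.sum_eq_zero fun i _ => by
    rw [Pi.single_eq_of_ne (Fin.castSucc_lt_last i).ne]; simp]
  simp only [Pi.single_eq_same, Fin.val_last, zero_add, mul_one, Even.neg_one_pow ⟨n, rfl⟩, one_mul]
  congr 1
  ext i j
  simp

/-- Scaling the columns: summing over all rows the determinant with that row rescaled entrywise
by `w` multiplies the determinant by the sum of `w`. -/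
theorem sum_det_updateRow_mul {n : Type*} [Fintype n] [DecidableEq n] (A : Matrix n n R)
    (w : n → R) :
    ∑ j, (A.updateRow j (fun i => w i * A j i)).det = (∑ i, w i) * A.det := by
  have h : ∀ j, (A.updateRow j (fun i => w i * A j i)).det =
      (A * Matrix.diagonal w * A.adjugate) j j := fun j => by
    rw [← Matrix.cramer_transpose_apply, Matrix.cramer_eq_adjugate_mulVec,
      ← Matrix.adjugate_transpose, Matrix.mulVec_transpose]
    simp only [Matrix.vecMul, dotProduct, Matrix.mul_apply (M := A * Matrix.diagonal w),
      Matrix.mul_diagonal, mul_comm (w _)]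
  simp only [h]
  change Matrix.trace _ = _
  rw [Matrix.trace_mul_comm, ← mul_assoc, Matrix.adjugate_mul, smul_mul_assoc, one_mul,
    Matrix.trace_smul, Matrix.trace_diagonal, smul_eq_mul, mul_comm]

theorem derivative_det {n : Type*} [Fintype n] [DecidableEq n] (A : Matrix n n R[X]) :
    derivative A.det = ∑ j, (A.updateRow j (fun i => derivative (A j i))).det := by
  simp only [Matrix.det_apply', derivative_sum]
  rw [Finset.sum_comm]
  refine Finset.sum_congr rfl fun σ _ => ?_
  rw [← Finset.mul_sum, ← Equiv.sum_comp σ, derivative_mul, derivative_intCast, zero_mul, zero_add,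
    derivative_prod_finset]
  congr 1
  refine Finset.sum_congr rfl fun i _ => ?_
  rw [← Finset.prod_erase_mul _ _ (Finset.mem_univ i), Matrix.updateRow_self]
  congr 1
  refine Finset.prod_congr rfl fun j hj => ?_
  rw [Matrix.updateRow_ne (σ.injective.ne (Finset.ne_of_mem_erase hj))]

end DeterminantIdentities

section Wronskian

variable {R : Type*} [CommRing R]

/-- The vector of `m`-th derivatives of a family of polynomials. -/
noncomputable def derivRow {n : ℕ} (f : Fin n → R[X]) (m : ℕ) : Fin n → R[X] :=
  fun i => derivative^[m] (f i)

/-- The Wronskian determinant of a family of polynomials. -/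
noncomputable def wronskianDet {n : ℕ} (f : Fin n → R[X]) : R[X] :=
  Matrix.det (Matrix.of fun j : Fin n => derivRow f j)

/-- The generalized Wronskian with derivatives of orders `0, …, k - 1, a, b`. -/
noncomputable def wronskianDet₂ {k : ℕ} (f : Fin (k + 2) → R[X]) (a b : ℕ) : R[X] :=
  borderDet (fun j : Fin k => derivRow f j) (derivRow f a) (derivRow f b)

theorem wronskianDet_eq {k : ℕ} (f : Fin (k + 2) → R[X]) :
    wronskianDet f = wronskianDet₂ f k (k + 1) := by
  rw [wronskianDet, wronskianDet₂, borderDet]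
  congr 1
  funext i
  refine Fin.lastCases ?_ (fun i => Fin.lastCases ?_ (fun i => ?_) i) i <;> funext j <;> simp

/-- The matrix underlying `wronskianDet₂ f k b`. -/
noncomputable def wronskianMatrix {k : ℕ} (f : Fin (k + 2) → R[X]) (b : ℕ) :
    Matrix (Fin (k + 2)) (Fin (k + 2)) R[X] :=
  Matrix.of (Fin.snoc (α := fun _ => Fin (k + 2) → R[X])
    (Fin.snoc (α := fun _ => Fin (k + 2) → R[X]) (fun j : Fin k => derivRow f j) (derivRow f k))
    (derivRow f b))

theorem wronskianMatrix_castSucc {k : ℕ} (f : Fin (k + 2) → R[X]) (b : ℕ) (j : Fin (k + 1)) :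
    wronskianMatrix f b j.castSucc = derivRow f j := by
  refine Fin.lastCases ?_ (fun j => ?_) j <;> funext i <;> simp [wronskianMatrix]

theorem wronskianMatrix_last {k : ℕ} (f : Fin (k + 2) → R[X]) (b : ℕ) :
    wronskianMatrix f b (Fin.last _) = derivRow f b := by
  funext i; simp [wronskianMatrix]

theorem wronskianMatrix_updateRow_last {k : ℕ} (f : Fin (k + 2) → R[X]) (b m : ℕ) :
    ((wronskianMatrix f b).updateRow (Fin.last _) (derivRow f m)).det = wronskianDet₂ f k m := by
  rw [wronskianMatrix, updateRow_snoc_last]; rfl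

theorem wronskianMatrix_updateRow_penultimate {k : ℕ} (f : Fin (k + 2) → R[X]) (b m : ℕ) :
    ((wronskianMatrix f b).updateRow (Fin.last _).castSucc (derivRow f m)).det =
      wronskianDet₂ f m b := by
  rw [wronskianMatrix, updateRow_snoc_castSucc, Fin.update_snoc_last]; rfl

theorem derivative_derivRow {n : ℕ} (f : Fin n → R[X]) (m : ℕ) (i : Fin n) :
    derivative (derivRow f m i) = derivRow f (m + 1) i := by
  simp only [derivRow, Function.iterate_succ_apply']

theorem det_updateRow_of_eq {n : Type*} [Fintype n] [DecidableEq n] (A : Matrix n n R) {i j : n}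
    (hij : i ≠ j) {v : n → R} (h : A j = v) : (A.updateRow i v).det = 0 := by
  refine Matrix.det_zero_of_row_eq hij ?_
  rw [Matrix.updateRow_self, Matrix.updateRow_ne hij.symm, h]

theorem derivative_wronskianDet₂ {k : ℕ} (f : Fin (k + 2) → R[X]) (b : ℕ) :
    derivative (wronskianDet₂ f k b) = wronskianDet₂ f (k + 1) b + wronskianDet₂ f k (b + 1) := by
  change derivative (wronskianMatrix f b).det = _
  rw [derivative_det, Fin.sum_univ_castSucc, Fin.sum_univ_castSucc]
  simp only [wronskianMatrix_castSucc, wronskianMatrix_last, derivative_derivRow]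
  rw [Finset.sum_eq_zero fun j _ => det_updateRow_of_eq (j := j.succ.castSucc) _
    (by simp [Fin.ext_iff]) (wronskianMatrix_castSucc f b j.succ)]
  change 0 + ((wronskianMatrix f b).updateRow (Fin.last _).castSucc (derivRow f (k + 1))).det +
    ((wronskianMatrix f b).updateRow (Fin.last _) (derivRow f (b + 1))).det = _
  rw [wronskianMatrix_updateRow_penultimate, wronskianMatrix_updateRow_last, zero_add]

/-- The effect of the operator `D² + x D` on a Wronskian of its eigenfunctions. -/
theorem wronskianDet₂_eigen {k : ℕ} (f : Fin (k + 2) → R[X]) (w : Fin (k + 2) → R)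
    (hf : ∀ i, derivative^[2] (f i) + X * derivative (f i) = C (w i) * f i) :
    wronskianDet₂ f k (k + 3) - wronskianDet₂ f (k + 1) (k + 2) +
      X * derivative (wronskianDet f) =
      C ((∑ i, w i) - ∑ j : Fin (k + 2), ((j : ℕ) : R)) * wronskianDet f := by
  have hrow : ∀ m, (fun i => C (w i) * derivRow f m i) =
      derivRow f (m + 2) + ((X : R[X]) • derivRow f (m + 1) + (m : R[X]) • derivRow f m) := by
    intro m
    funext i
    simp only [derivRow, Pi.add_apply, Pi.smul_apply, smul_eq_mul]
    induction m with
    | zero => simpa using (hf i).symm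
    | succ m ih =>
      have := congrArg derivative ih
      simp only [derivative_C, derivative_add, derivative_mul, derivative_X,
        derivative_natCast] at this
      simp only [← Function.iterate_succ_apply' derivative, Nat.succ_eq_add_one] at this
      push_cast
      linear_combination this
  have hcs : ∀ j : Fin (k + 2), wronskianMatrix f (k + 1) j = derivRow f j := fun j =>
    Fin.lastCases (wronskianMatrix_last f _) (fun j => wronskianMatrix_castSucc f _ j) j
  have hdet : (wronskianMatrix f (k + 1)).det = wronskianDet f := (wronskianDet_eq f).symm
  have h := sum_det_updateRow_mul (wronskianMatrix f (k + 1)) (fun i => C (w i))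
  simp only [hcs, hrow, Matrix.det_updateRow_add, Matrix.det_updateRow_smul,
    Finset.sum_add_distrib] at h
  have h1 : derivative (wronskianDet f) = ∑ j : Fin (k + 2),
      ((wronskianMatrix f (k + 1)).updateRow j (derivRow f (j + 1))).det := by
    rw [← hdet, derivative_det]
    simp only [hcs, derivative_derivRow]
  have h2 : ∑ j : Fin (k + 2), ((wronskianMatrix f (k + 1)).updateRow j (derivRow f (j + 2))).det =
      wronskianDet₂ f k (k + 3) - wronskianDet₂ f (k + 1) (k + 2) := by
    rw [Fin.sum_univ_castSucc, Fin.sum_univ_castSucc,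
      Finset.sum_eq_zero fun j _ => det_updateRow_of_eq (j := j.succ.succ) _
        (by simp [Fin.ext_iff, add_assoc]) (by simp [hcs])]
    simp only [Fin.val_last, Fin.val_castSucc]
    rw [wronskianMatrix_updateRow_penultimate, wronskianMatrix_updateRow_last,
      wronskianDet₂, borderDet_swap]
    simp only [wronskianDet₂]
    ring
  have h3 : ∀ j : Fin (k + 2), ((wronskianMatrix f (k + 1)).updateRow j (derivRow f j)).det =
      wronskianDet f := fun j => by rw [← hcs, Matrix.updateRow_eq_self, hdet]
  simp only [h3, ← Finset.mul_sum, ← h1, h2, hdet, ← Finset.sum_mul] at h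
  simp only [C_sub, map_sum, map_natCast]
  linear_combination h

/-- The three-term relation linking the Wronskians of `f` and of `f` with one more function. -/
theorem wronskianDet₂_plucker {k : ℕ} (f : Fin (k + 2) → R[X]) (g : R[X]) :
    let F : Fin (k + 3) → R[X] := Fin.snoc (α := fun _ => R[X]) f g
    wronskianDet₂ f k (k + 2 + 1) * wronskianDet₂ F (k + 1) (k + 2) -
      wronskianDet₂ f k (k + 2) * wronskianDet₂ F (k + 1) (k + 3) +
      wronskianDet₂ f k (k + 1) * wronskianDet₂ F (k + 2) (k + 3) = 0 := by
  intro F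
  have hb : ∀ m, borderDet (fun j : Fin (k + 1) => derivRow F j) (derivRow F m)
      (Pi.single (Fin.last _) 1) = wronskianDet₂ f k m := by
    intro m
    rw [borderDet, det_snoc_single_last, wronskianDet₂, borderDet]
    congr 1
    funext i
    refine Fin.lastCases ?_ (fun i => Fin.lastCases ?_ (fun i => ?_) i) i <;>
      funext j <;> simp [F, derivRow]
  have h := borderDet_plucker (fun j : Fin (k + 1) => derivRow F j) (derivRow F (k + 1))
    (Pi.single (Fin.last _) 1) (derivRow F (k + 2)) (derivRow F (k + 3))
  rw [hb, borderDet_swap _ (derivRow F (k + 3)) (Pi.single _ _), hb, hb] at h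
  simp only [wronskianDet₂] at h ⊢
  linear_combination h

end Wronskian

theorem hirotaBil_wronskianDet {k : ℕ} (f : Fin (k + 2) → ℂ[X]) (g : ℂ[X]) (w : Fin (k + 2) → ℂ)
    (v : ℂ) (hf : ∀ i, derivative^[2] (f i) + X * derivative (f i) = C (w i) * f i)
    (hg : derivative^[2] g + X * derivative g = C v * g) :
    hirotaBil (v - (k + 2)) (wronskianDet f)
      (wronskianDet (Fin.snoc (α := fun _ => ℂ[X]) f g : Fin (k + 3) → ℂ[X])) = 0 := by
  set F : Fin (k + 3) → ℂ[X] := Fin.snoc (α := fun _ => ℂ[X]) f g with hF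
  have hFe : ∀ i, derivative^[2] (F i) + X * derivative (F i) =
      C (Fin.snoc (α := fun _ => ℂ) w v i : ℂ) * F i := fun i => by
    refine Fin.lastCases ?_ (fun i => ?_) i
    · simpa [hF] using hg
    · simpa [hF] using hf i
  have e1 := wronskianDet₂_eigen f w hf
  have e2 := wronskianDet₂_eigen F _ hFe
  have p := wronskianDet₂_plucker f g
  have z : ∀ {l : ℕ} (f : Fin (l + 2) → ℂ[X]) (m : ℕ), wronskianDet₂ f m m = 0 :=
    fun f m => borderDet_self _ _
  have d1 : derivative (wronskianDet f) = wronskianDet₂ f k (k + 2) := by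
    rw [wronskianDet_eq, derivative_wronskianDet₂, z, zero_add]
  have d2 : derivative (wronskianDet F) = wronskianDet₂ F (k + 1) (k + 3) := by
    rw [wronskianDet_eq, derivative_wronskianDet₂, z, zero_add]
  rw [Fin.sum_univ_castSucc (n := k + 2), Fin.sum_univ_castSucc (n := k + 2)] at e2
  simp only [Fin.snoc_castSucc, Fin.snoc_last, Fin.val_castSucc, Fin.val_last] at e2
  rw [hirotaBil, d1, d2, derivative_wronskianDet₂, derivative_wronskianDet₂]
  rw [d1] at e1
  rw [d2] at e2
  rw [wronskianDet_eq] at e1 e2 ⊢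
  rw [wronskianDet_eq]
  simp only [C_sub, C_add, map_natCast, map_ofNat, Nat.cast_add, Nat.cast_ofNat] at e1 e2 ⊢
  change _ - _ + X * wronskianDet₂ F (k + 1) (k + 3) = _ at e2
  linear_combination 2 * p - e1 * wronskianDet₂ F (k + 1) (k + 2) + e2 * wronskianDet₂ f k (k + 1)

theorem coeff_p2 (c : ℂ) (n m : ℕ) : (p2 c n).coeff m =
    ∑ j ∈ Finset.range (n / 2 + 1),
      if m = n - 2 * j then c ^ j / ((n - 2 * j).factorial * (j.factorial : ℂ)) else 0 := by
  simp only [p2, finsetSum_coeff, coeff_C_mul, coeff_X_pow, mul_ite, mul_one, mul_zero]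

theorem coeff_p2_add (c : ℂ) (m j : ℕ) :
    (p2 c (m + 2 * j)).coeff m = c ^ j / (m.factorial * j.factorial) := by
  rw [coeff_p2, Finset.sum_eq_single j]
  · simp
  · intro i hi hij
    rw [Finset.mem_range] at hi
    exact if_neg (by omega)
  · intro h
    exact absurd (Finset.mem_range.2 (by omega)) h

theorem coeff_p2_of_ne (c : ℂ) {n m : ℕ} (h : ∀ j, n ≠ m + 2 * j) : (p2 c n).coeff m = 0 := by
  rw [coeff_p2]
  refine Finset.sum_eq_zero fun j hj => if_neg fun hm => h j ?_
  rw [Finset.mem_range] at hj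
  omega

theorem p2_zero (c : ℂ) : p2 c 0 = 1 := by simp [p2]

theorem derivative_p2_succ (c : ℂ) (n : ℕ) : derivative (p2 c (n + 1)) = p2 c n := by
  ext m
  rw [coeff_derivative]
  by_cases h : ∃ j, n = m + 2 * j
  · obtain ⟨j, rfl⟩ := h
    rw [show m + 2 * j + 1 = m + 1 + 2 * j by ring, coeff_p2_add, coeff_p2_add,
      Nat.factorial_succ]
    have h1 : ((m : ℂ) + 1) ≠ 0 := Nat.cast_add_one_ne_zero m
    have h2 : (m.factorial : ℂ) ≠ 0 := Nat.cast_ne_zero.2 m.factorial_ne_zero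
    have h3 : (j.factorial : ℂ) ≠ 0 := Nat.cast_ne_zero.2 j.factorial_ne_zero
    push_cast
    field_simp
  · push Not at h
    rw [coeff_p2_of_ne c h, coeff_p2_of_ne c fun j hj => h j (by omega), zero_mul]

theorem iterate_derivative_p2 (c : ℂ) (n j : ℕ) :
    derivative^[j] (p2 c n) = p2Z c ((n : ℤ) - j) := by
  induction j generalizing n with
  | zero => simp [p2Z]
  | succ j ih =>
    rw [Function.iterate_succ_apply]
    cases n with
    | zero =>
      rw [p2_zero, derivative_one, iterate_derivative_zero, p2Z, if_neg (by omega)]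
    | succ n =>
      rw [derivative_p2_succ, ih]
      congr 1
      push_cast
      ring

/-- `p_n(x, 1/2)` is an eigenfunction of `D² + x D` with eigenvalue `n`. -/
theorem p2_half_eigen (n : ℕ) :
    derivative^[2] (p2 (1 / 2) n) + X * derivative (p2 (1 / 2) n) =
      C (n : ℂ) * p2 (1 / 2) n := by
  ext m
  have hX : (X * derivative (p2 (1 / 2) n)).coeff m = m * (p2 (1 / 2) n).coeff m := by
    cases m with
    | zero => simp
    | succ m => rw [coeff_X_mul, coeff_derivative]; push_cast; ring
  rw [coeff_add, hX, coeff_C_mul, Function.iterate_succ_apply, Function.iterate_one,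
    coeff_derivative, coeff_derivative]
  by_cases h : ∃ j, n = m + 2 * j
  · obtain ⟨j, rfl⟩ := h
    rw [coeff_p2_add]
    cases j with
    | zero => rw [coeff_p2_of_ne _ fun j hj => by omega]; simp
    | succ j =>
      rw [show m + 2 * (j + 1) = m + 1 + 1 + 2 * j by ring, coeff_p2_add]
      simp only [Nat.factorial_succ]
      have h1 : ((m : ℂ) + 1) ≠ 0 := Nat.cast_add_one_ne_zero m
      have hm2 : ((m : ℂ) + 1 + 1) ≠ 0 := by
        simpa using Nat.cast_add_one_ne_zero (R := ℂ) (m + 1)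
      have hj1 : ((j : ℂ) + 1) ≠ 0 := Nat.cast_add_one_ne_zero j
      have h2 : (m.factorial : ℂ) ≠ 0 := Nat.cast_ne_zero.2 m.factorial_ne_zero
      have h3 : (j.factorial : ℂ) ≠ 0 := Nat.cast_ne_zero.2 j.factorial_ne_zero
      push_cast
      field_simp
      ring
  · push Not at h
    rw [coeff_p2_of_ne _ h, coeff_p2_of_ne _ fun j hj => h (j + 1) (by omega)]
    simp

theorem wronskianDet_comp_perm {R : Type*} [CommRing R] {n : ℕ} (f : Fin n → R[X])
    (σ : Equiv.Perm (Fin n)) :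
    wronskianDet (f ∘ σ) = wronskianDet f ∨ wronskianDet (f ∘ σ) = -wronskianDet f := by
  have h := Matrix.det_permute' σ (Matrix.of fun j : Fin n => derivRow f j)
  rcases Int.units_eq_one_or (Equiv.Perm.sign σ) with hs | hs <;> rw [hs] at h
  · exact Or.inl (h.trans (by rw [Units.val_one, Int.cast_one, one_mul, wronskianDet]))
  · exact Or.inr (h.trans (by
      rw [Units.val_neg, Units.val_one, Int.cast_neg, Int.cast_one, neg_one_mul, wronskianDet]))

theorem jacobiTrudi_succ (c : ℂ) (ℓ : ℕ) (lam : ℕ → ℕ) (h : lam ℓ = 0) :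
    jacobiTrudi c (ℓ + 1) lam = jacobiTrudi c ℓ lam := by
  refine Eq.trans ?_ (det_snoc_single_last (fun (i : Fin ℓ) (j : Fin (ℓ + 1)) =>
    p2Z c ((lam i : ℤ) - (i : ℕ) + (j : ℕ))))
  rw [jacobiTrudi]
  congr 1
  ext1 i j
  refine Fin.lastCases ?_ (fun i => ?_) i
  · simp only [Matrix.of_apply, Fin.snoc_last, Fin.val_last, h]
    refine Fin.lastCases ?_ (fun j => ?_) j
    · simp [p2Z, p2_zero]
    · rw [Pi.single_eq_of_ne (Fin.castSucc_lt_last j).ne, p2Z, if_neg]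
      simp
  · simp

theorem jacobiTrudi_of_le (c : ℂ) {ℓ N : ℕ} (lam : ℕ → ℕ) (h : ∀ i, ℓ ≤ i → lam i = 0)
    (hN : ℓ ≤ N) : jacobiTrudi c N lam = jacobiTrudi c ℓ lam := by
  induction N, hN using Nat.le_induction with
  | base => rfl
  | succ N hN ih => rw [jacobiTrudi_succ c N lam (h N hN), ih]

theorem jacobiTrudi_eq_wronskianDet (c : ℂ) (N : ℕ) (lam : ℕ → ℕ) :
    jacobiTrudi c N lam = wronskianDet (fun i : Fin N => p2 c (lam i + (N - 1 - i))) ∨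
      jacobiTrudi c N lam = -wronskianDet (fun i : Fin N => p2 c (lam i + (N - 1 - i))) := by
  have h := Matrix.det_permute Fin.revPerm
    (Matrix.of fun j : Fin N => derivRow (fun i : Fin N => p2 c (lam i + (N - 1 - i))) j)
  have h2 : jacobiTrudi c N lam = ((Matrix.of fun j : Fin N =>
      derivRow (fun i : Fin N => p2 c (lam i + (N - 1 - i))) j).submatrix Fin.revPerm id).det := by
    rw [jacobiTrudi, ← Matrix.det_transpose]
    congr 1
    ext1 j i
    simp only [Matrix.transpose_apply, Matrix.of_apply, Matrix.submatrix_apply, derivRow, id,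
      iterate_derivative_p2, Fin.revPerm_apply, Fin.val_rev]
    congr 1
    omega
  rw [← h2] at h
  rcases Int.units_eq_one_or (Equiv.Perm.sign (Fin.revPerm (n := N))) with hs | hs <;> rw [hs] at h
  · exact Or.inl (h.trans (by rw [Units.val_one, Int.cast_one, one_mul, wronskianDet]))
  · exact Or.inr (h.trans (by
      rw [Units.val_neg, Units.val_one, Int.cast_neg, Int.cast_one, neg_one_mul, wronskianDet]))

theorem IsMayaPartition.exists_enumeration {M : Set ℤ} {lam : ℕ → ℕ} {c : ℤ}
    (hM : IsMayaPartition M lam c) {ℓ N : ℕ} (h : ∀ i, ℓ ≤ i → lam i = 0) (hN : ℓ ≤ N) :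
    ∃ e : Fin N → ℕ, Function.Injective e ∧ (∀ q : ℕ, q ∈ Set.range e ↔ c - N + q ∈ M) ∧
      ∀ t, (jacobiTrudi t ℓ lam = wronskianDet (fun i => p2 t (e i)) ∨
        jacobiTrudi t ℓ lam = -wronskianDet (fun i => p2 t (e i))) := by
  obtain ⟨hanti, -, hrange⟩ := hM
  refine ⟨fun i => lam i + (N - 1 - i), ?_, ?_, ?_⟩
  · have hs : StrictAnti fun i : Fin N => lam i + (N - 1 - i) := fun i j hij => by
      have h1 := hanti hij.le
      have h2 : (i : ℕ) < j := hij
      have h3 := j.isLt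
      dsimp only at h1 ⊢
      omega
    exact hs.injective
  · intro q
    rw [← hrange]
    constructor
    · rintro ⟨i, rfl⟩
      refine ⟨i, ?_⟩
      have := i.isLt
      dsimp only
      push_cast
      omega
    · rintro ⟨i, hi⟩
      dsimp only at hi
      have hiN : i < N := by
        by_contra hiN
        rw [h i (by omega)] at hi
        omega
      refine ⟨⟨i, hiN⟩, ?_⟩
      dsimp only
      omega
  · intro t
    rw [← jacobiTrudi_of_le t lam h hN]
    exact jacobiTrudi_eq_wronskianDet t N lam

theorem exists_perm_of_range_eq {α : Type*} {n : ℕ} {e e' : Fin n → α}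
    (he : Function.Injective e) (he' : Function.Injective e')
    (h : Set.range e' = Set.range e) : ∃ σ : Equiv.Perm (Fin n), e' = e ∘ σ := by
  refine ⟨(Equiv.ofInjective e' he').trans ((Equiv.setCongr h).trans (Equiv.ofInjective e he).symm),
    ?_⟩
  funext i
  simp [Equiv.apply_ofInjective_symm]

theorem hirotaBil_neg_left (c : ℂ) (F G : ℂ[X]) : hirotaBil c (-F) G = -hirotaBil c F G := by
  simp only [hirotaBil, derivative_neg]; ring

theorem hirotaBil_neg_right (c : ℂ) (F G : ℂ[X]) : hirotaBil c F (-G) = -hirotaBil c F G := by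
  simp only [hirotaBil, derivative_neg]; ring

/-- Adding one point `a` to a Maya diagram of charge `c` gives a solution of the bilinear equation
with constant `a - c`. -/
theorem IsMayaPartition.hirotaBil_insert {M : Set ℤ} {lam lam' : ℕ → ℕ} {a c c' : ℤ} {ℓ ℓ' : ℕ}
    (hM : IsMayaPartition M lam c) (hM' : IsMayaPartition (insert a M) lam' c') (ha : a ∉ M)
    (h : ∀ i, ℓ ≤ i → lam i = 0) (h' : ∀ i, ℓ' ≤ i → lam' i = 0) :
    hirotaBil ((a : ℂ) - c) (jacobiTrudi (1 / 2) ℓ lam) (jacobiTrudi (1 / 2) ℓ' lam') = 0 := by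
  obtain ⟨k, hk⟩ : ∃ k : ℕ, k = ℓ + ℓ' + (c' - c).natAbs + (a - c).natAbs := ⟨_, rfl⟩
  obtain ⟨e, he, hr, hW⟩ := hM.exists_enumeration (N := k + 2) h (by omega)
  obtain ⟨N', hN'⟩ : ∃ N' : ℕ, (N' : ℤ) = k + 2 + (c' - c) := ⟨(k + 2 + (c' - c)).toNat, by omega⟩
  obtain ⟨e', he', hr', hW'⟩ := hM'.exists_enumeration (N := N') h' (by omega)
  obtain ⟨q, hq⟩ : ∃ q : ℕ, (q : ℤ) = a - (c - (k + 2)) := ⟨(a - (c - (k + 2))).toNat, by omega⟩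
  have hqe : q ∉ Set.range e := by
    rw [hr]
    rwa [show c - ((k + 2 : ℕ) : ℤ) + q = a by push_cast; omega]
  have hrange : Set.range e' = Set.range (Fin.snoc (α := fun _ => ℕ) e q : Fin (k + 3) → ℕ) := by
    rw [Fin.range_snoc]
    ext p
    rw [hr', Set.mem_insert_iff, Set.mem_insert_iff, hr]
    push_cast
    rw [show c' - N' + p = c - (k + 2) + (p : ℤ) by omega]
    refine or_congr_left ⟨fun hp => by omega, fun hp => by omega⟩
  have hinj : Function.Injective (Fin.snoc (α := fun _ => ℕ) e q : Fin (k + 3) → ℕ) :=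
    Fin.snoc_injective_iff.2 ⟨he, hqe⟩
  obtain rfl : N' = k + 3 := by
    have := congrArg Set.ncard hrange
    rwa [← Set.image_univ, ← Set.image_univ, Set.ncard_image_of_injective _ he',
      Set.ncard_image_of_injective _ hinj, Set.ncard_univ, Set.ncard_univ, Nat.card_fin,
      Nat.card_fin] at this
  obtain ⟨σ, hσ⟩ := exists_perm_of_range_eq hinj he' hrange
  have key := hirotaBil_wronskianDet (fun i => p2 (1 / 2) (e i)) (p2 (1 / 2) q) (fun i => (e i : ℂ))
    q (fun i => p2_half_eigen _) (p2_half_eigen q)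
  have hcomp : (Fin.snoc (α := fun _ => ℂ[X]) (fun i => p2 (1 / 2) (e i)) (p2 (1 / 2) q) :
      Fin (k + 3) → ℂ[X]) = fun i => p2 (1 / 2) (Fin.snoc (α := fun _ => ℕ) e q i) := by
    funext i
    refine Fin.lastCases ?_ (fun i => ?_) i <;> simp
  have hconst : (q : ℂ) - (k + 2) = a - c := by
    have : (q : ℂ) = a - (c - (k + 2)) := by exact_mod_cast congrArg (Int.cast : ℤ → ℂ) hq
    rw [this]; ring
  rw [hcomp, hconst] at key
  have hperm := wronskianDet_comp_perm
    (fun i : Fin (k + 3) => p2 (1 / 2) (Fin.snoc (α := fun _ => ℕ) e q i)) σ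
  have hσW := hW' (1 / 2)
  rw [hσ] at hσW
  rcases hW (1 / 2) with h1 | h1 <;> rcases hσW with h2 | h2 <;> rcases hperm with h3 | h3 <;>
    simp only [Function.comp_def] at h2 h3 <;>
    simp only [h1, h2, h3, hirotaBil_neg_left, hirotaBil_neg_right, key, neg_zero]

theorem IsMayaPartition.translate {M : Set ℤ} {lam : ℕ → ℕ} {c : ℤ} (hM : IsMayaPartition M lam c)
    (d : ℤ) : IsMayaPartition (Set.image (· + d) M) lam (c + d) := by
  refine ⟨hM.1, hM.2.1, ?_⟩
  rw [← hM.2.2, ← Set.range_comp]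
  congr 1
  funext i
  simp only [Function.comp_apply]
  ring

theorem IsMayaPartition.charge_eq {m n : ℤ} {lam : ℕ → ℕ} {c : ℤ}
    (hM : IsMayaPartition (mayaSet m n) lam c) : c = m + n := by
  obtain ⟨L, hL⟩ := hM.2.1
  obtain ⟨k, hk⟩ : ∃ k : ℤ, k = -(L + m.natAbs + n.natAbs + c.natAbs : ℤ) := ⟨_, rfl⟩
  obtain ⟨N, hN⟩ : ∃ N : ℕ, (N : ℤ) = c - 3 * k := ⟨(c - 3 * k).toNat, by omega⟩
  obtain ⟨e, he, hr, -⟩ := hM.exists_enumeration (N := N) hL (by omega)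
  have hcard : Finset.univ.image (fun i => (e i : ℤ) + 3 * k) =
      (Finset.Ico k m).image (fun j => 3 * j) ∪ (Finset.Ico k n).image (fun j => 3 * j + 1) ∪
        (Finset.Ico k 0).image (fun j => 3 * j + 2) := by
    ext z
    have hz : z ∈ Finset.univ.image (fun i => (e i : ℤ) + 3 * k) ↔
        3 * k ≤ z ∧ z ∈ mayaSet m n := by
      rw [Finset.mem_image]
      constructor
      · rintro ⟨i, -, rfl⟩
        refine ⟨by omega, ?_⟩
        have := (hr (e i)).1 ⟨i, rfl⟩
        rwa [show c - N + (e i : ℤ) = e i + 3 * k by omega] at this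
      · rintro ⟨h1, h2⟩
        obtain ⟨i, hi⟩ := (hr (z - 3 * k).toNat).2
          (by rwa [show c - N + ((z - 3 * k).toNat : ℤ) = z by omega])
        exact ⟨i, Finset.mem_univ _, by omega⟩
    rw [hz]
    simp only [mayaSet, Set.mem_union, Set.mem_ofPred_eq, Finset.mem_union, Finset.mem_image,
      Finset.mem_Ico]
    constructor
    · rintro ⟨h1, (⟨j, hj, rfl⟩ | ⟨j, hj, rfl⟩) | ⟨j, hj, rfl⟩⟩
      · exact Or.inl (Or.inl ⟨j, ⟨by omega, hj⟩, rfl⟩)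
      · exact Or.inl (Or.inr ⟨j, ⟨by omega, hj⟩, rfl⟩)
      · exact Or.inr ⟨j, ⟨by omega, hj⟩, rfl⟩
    · rintro ((⟨j, hj, rfl⟩ | ⟨j, hj, rfl⟩) | ⟨j, hj, rfl⟩)
      · exact ⟨by omega, Or.inl (Or.inl ⟨j, hj.2, rfl⟩)⟩
      · exact ⟨by omega, Or.inl (Or.inr ⟨j, hj.2, rfl⟩)⟩
      · exact ⟨by omega, Or.inr ⟨j, hj.2, rfl⟩⟩
  have := congrArg Finset.card hcard
  rw [Finset.card_image_of_injective _ (fun i j hij => he (by simpa using hij)),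
    Finset.card_union_of_disjoint, Finset.card_union_of_disjoint,
    Finset.card_image_of_injective _ (fun i j hij => by simpa using hij),
    Finset.card_image_of_injective _ (fun i j hij => by simpa using hij),
    Finset.card_image_of_injective _ (fun i j hij => by simpa using hij),
    Int.card_Ico, Int.card_Ico, Int.card_Ico, Finset.card_univ, Fintype.card_fin] at this
  · omega
  · rw [Finset.disjoint_left]
    simp only [Finset.mem_image]
    rintro z ⟨i, -, rfl⟩ ⟨j, -, hj⟩
    omega
  · rw [Finset.disjoint_left]
    simp only [Finset.mem_image, Finset.mem_union]
    rintro z (⟨i, -, rfl⟩ | ⟨i, -, rfl⟩) ⟨j, -, hj⟩ <;> omega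

theorem mem_mayaSet {m n z : ℤ} : z ∈ mayaSet m n ↔
    z % 3 = 0 ∧ z / 3 < m ∨ z % 3 = 1 ∧ z / 3 < n ∨ z % 3 = 2 ∧ z / 3 < 0 := by
  simp only [mayaSet, Set.mem_union, Set.mem_ofPred_eq]
  constructor
  · rintro ((⟨k, hk, rfl⟩ | ⟨k, hk, rfl⟩) | ⟨k, hk, rfl⟩) <;> omega
  · rintro (h | h | h)
    · exact Or.inl (Or.inl ⟨z / 3, h.2, by omega⟩)
    · exact Or.inl (Or.inr ⟨z / 3, h.2, by omega⟩)
    · exact Or.inr ⟨z / 3, h.2, by omega⟩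

/-- **Second family of rational-solution `τ`-functions of Painlevé IV from 3-reduced
Schur polynomials:** for all `m, n ∈ ℤ`, the triple
`(τ₀, τ₁, τ₂) = (s_{m,n}, s_{m,n+1}, s_{m+1,n+1})` satisfies the bilinear form of the
fourth Painlevé equation with parameters
`(α₀, α₁, α₂) = (3n + 2, 3(m − n) − 1, −3m + 2)`. -/
theorem okamoto_schur_second_family (m n : ℤ) (τ0 τ1 τ2 : Polynomial ℂ)
    (h0 : IsOkamotoS m n τ0) (h1 : IsOkamotoS m (n + 1) τ1)
    (h2 : IsOkamotoS (m + 1) (n + 1) τ2) :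
    hirotaBil ((((3 * n + 2 : ℤ) : ℂ) - ((3 * (m - n) - 1 : ℤ) : ℂ)) / 3) τ0 τ1 = 0 ∧
    hirotaBil ((((3 * (m - n) - 1 : ℤ) : ℂ) - ((-3 * m + 2 : ℤ) : ℂ)) / 3) τ1 τ2 = 0 ∧
    hirotaBil ((((-3 * m + 2 : ℤ) : ℂ) - ((3 * n + 2 : ℤ) : ℂ)) / 3) τ2 τ0 = 0 := by
  obtain ⟨lam0, c0, ℓ0, hM0, hl0, rfl⟩ := h0
  obtain ⟨lam1, c1, ℓ1, hM1, hl1, rfl⟩ := h1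
  obtain ⟨lam2, c2, ℓ2, hM2, hl2, rfl⟩ := h2
  have e0 : mayaSet m (n + 1) = insert (3 * n + 1) (mayaSet m n) := by
    ext z
    rw [Set.mem_insert_iff, mem_mayaSet, mem_mayaSet]
    omega
  have e1 : mayaSet (m + 1) (n + 1) = insert (3 * m) (mayaSet m (n + 1)) := by
    ext z
    rw [Set.mem_insert_iff, mem_mayaSet, mem_mayaSet]
    omega
  have e2 : Set.image (· + 3) (mayaSet m n) = insert 2 (mayaSet (m + 1) (n + 1)) := by
    ext z
    rw [Set.image_add_right, Set.mem_preimage, Set.mem_insert_iff, mem_mayaSet, mem_mayaSet]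
    omega
  have k0 := (e0 ▸ hM1 : IsMayaPartition (insert (3 * n + 1) (mayaSet m n)) lam1 c1)
  have k1 := (e1 ▸ hM2 : IsMayaPartition (insert (3 * m) (mayaSet m (n + 1))) lam2 c2)
  have k2 := (e2 ▸ hM0.translate 3 :
    IsMayaPartition (insert 2 (mayaSet (m + 1) (n + 1))) lam0 (c0 + 3))
  refine ⟨?_, ?_, ?_⟩
  · convert hM0.hirotaBil_insert k0 (by rw [mem_mayaSet]; omega) hl0 hl1 using 2
    rw [hM0.charge_eq]
    push_cast
    ring
  · convert hM1.hirotaBil_insert k1 (by rw [mem_mayaSet]; omega) hl1 hl2 using 2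
    rw [hM1.charge_eq]
    push_cast
    ring
  · convert hM2.hirotaBil_insert k2 (by rw [mem_mayaSet]; omega) hl2 hl0 using 2
    rw [hM2.charge_eq]
    push_cast
    ring
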